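/- Every weak Hopf algebra A over a field K possesses a nonzero left integral: there exists l ∈ A with l ≠ 0 and x l = Π^L(x) l for all x ∈ A. -/

import Mathlib

open TensorProduct

noncomputable section

variable (K : Type*) [Field K] (A : Type*) [Ring A] [Algebra K A]

/-- `Π^L(x) = Σ ε(1₍₁₎ x) 1₍₂₎`. -/
def piL (Δ : A →ₗ[K] A ⊗[K] A) (ε : A →ₗ[K] K) : A →ₗ[K] A :=
  (TensorProduct.lid K A).toLinearMap ∘ₗ ε.rTensor A ∘ₗ
    LinearMap.mulLeft K (Δ 1) ∘ₗ (TensorProduct.mk K A A).flip 1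

/-- `Π^R(x) = Σ 1₍₁₎ ε(x 1₍₂₎)`. -/
def piR (Δ : A →ₗ[K] A ⊗[K] A) (ε : A →ₗ[K] K) : A →ₗ[K] A :=
  (TensorProduct.rid K A).toLinearMap ∘ₗ ε.lTensor A ∘ₗ
    LinearMap.mulRight K (Δ 1) ∘ₗ TensorProduct.mk K A A 1

/-- A weak bialgebra structure on the `K`-algebra `A`, with comultiplication `Δ`
and counit `ε`. -/
structure WeakBialgebra (Δ : A →ₗ[K] A ⊗[K] A) (ε : A →ₗ[K] K) : Prop where
  coassoc : ∀ x : A,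
    (TensorProduct.assoc K A A A) (Δ.rTensor A (Δ x)) = Δ.lTensor A (Δ x)
  counit_left : ∀ x : A, (TensorProduct.lid K A) (ε.rTensor A (Δ x)) = x
  counit_right : ∀ x : A, (TensorProduct.rid K A) (ε.lTensor A (Δ x)) = x
  comul_mul : ∀ x y : A, Δ (x * y) = Δ x * Δ y
  weak_counit_a : ∀ x y z : A,
    ε (x * y * z) =
      LinearMap.mul' K K (TensorProduct.map (ε ∘ₗ LinearMap.mulLeft K x)
        (ε ∘ₗ LinearMap.mulRight K z) (Δ y))
  weak_counit_b : ∀ x y z : A,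
    ε (x * y * z) =
      LinearMap.mul' K K (TensorProduct.map (ε ∘ₗ LinearMap.mulRight K z)
        (ε ∘ₗ LinearMap.mulLeft K x) (Δ y))
  weak_comul_unit_a :
    Δ.rTensor A (Δ 1) =
      (Δ 1 ⊗ₜ[K] (1 : A)) * ((TensorProduct.assoc K A A A).symm ((1 : A) ⊗ₜ[K] Δ 1))
  weak_comul_unit_b :
    Δ.rTensor A (Δ 1) =
      ((TensorProduct.assoc K A A A).symm ((1 : A) ⊗ₜ[K] Δ 1)) * (Δ 1 ⊗ₜ[K] (1 : A))

/-- A weak Hopf algebra structure: a weak bialgebra together with an antipode `S`. -/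
structure WeakHopfAlgebra (Δ : A →ₗ[K] A ⊗[K] A) (ε : A →ₗ[K] K) (S : A →ₗ[K] A) : Prop where
  toWeakBialgebra : WeakBialgebra K A Δ ε
  antipode_a : ∀ x : A,
    LinearMap.mul' K A (LinearMap.lTensor A S (Δ x)) = piL K A Δ ε x
  antipode_b : ∀ x : A,
    LinearMap.mul' K A (LinearMap.rTensor A S (Δ x)) = piR K A Δ ε x
  antipode_c : ∀ x : A,
    LinearMap.mul' K A (TensorProduct.map S (LinearMap.mul' K A ∘ₗ LinearMap.lTensor A S)
      (LinearMap.lTensor A Δ (Δ x))) = S x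

namespace WeakBialgebra

open LinearMap

section

variable {K A} {Δ : A →ₗ[K] A ⊗[K] A} {ε : A →ₗ[K] K}

/-- The coalgebra underlying a weak bialgebra. -/
@[reducible] def toCoalgebra (h : WeakBialgebra K A Δ ε) : Coalgebra K A where
  comul := Δ
  counit := ε
  coassoc := LinearMap.ext h.coassoc
  rTensor_counit_comp_comul := LinearMap.ext fun x =>
    (TensorProduct.lid K A).injective (by simpa using h.counit_left x)
  lTensor_counit_comp_comul := LinearMap.ext fun x =>
    (TensorProduct.rid K A).injective (by simpa using h.counit_right x)

theorem piL_apply (x : A) :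
    piL K A Δ ε x = TensorProduct.lid K A (ε.rTensor A (Δ 1 * (x ⊗ₜ 1))) := rfl

theorem piR_apply (x : A) :
    piR K A Δ ε x = TensorProduct.rid K A (ε.lTensor A ((1 ⊗ₜ x) * Δ 1)) := rfl

theorem piL_eq (x : A) :
    piL K A Δ ε x = TensorProduct.lid K A ((ε ∘ₗ mulRight K x).rTensor A (Δ 1)) := by
  rw [piL_apply]
  generalize Δ 1 = u
  induction u with
  | zero => simp
  | tmul a b => simp
  | add u v hu hv => simp only [add_mul, map_add, hu, hv]

theorem piR_eq (x : A) :
    piR K A Δ ε x = TensorProduct.rid K A ((ε ∘ₗ mulLeft K x).lTensor A (Δ 1)) := by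
  rw [piR_apply]
  generalize Δ 1 = u
  induction u with
  | zero => simp
  | tmul a b => simp
  | add u v hu hv => simp only [mul_add, map_add, hu, hv]

/-- `Π̄(y) = Σ ε(y 1₍₁₎) 1₍₂₎`. -/
def piBar (Δ : A →ₗ[K] A ⊗[K] A) (ε : A →ₗ[K] K) : A →ₗ[K] A :=
  (TensorProduct.lid K A).toLinearMap ∘ₗ ε.rTensor A ∘ₗ
    mulRight K (Δ 1) ∘ₗ (TensorProduct.mk K A A).flip 1

theorem piBar_eq (x : A) :
    piBar Δ ε x = TensorProduct.lid K A ((ε ∘ₗ mulLeft K x).rTensor A (Δ 1)) := by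
  simp only [piBar, LinearMap.comp_apply, mulRight_apply, LinearEquiv.coe_coe,
    LinearMap.flip_apply, TensorProduct.mk_apply]
  generalize Δ 1 = u
  induction u with
  | zero => simp
  | tmul a b => simp
  | add u v hu hv => simp only [mul_add, map_add, hu, hv]

theorem comul_one_mul (h : WeakBialgebra K A Δ ε) (x : A) : Δ 1 * Δ x = Δ x := by
  rw [← h.comul_mul, one_mul]

theorem comul_mul_one (h : WeakBialgebra K A Δ ε) (x : A) : Δ x * Δ 1 = Δ x := by
  rw [← h.comul_mul, mul_one]

theorem piL_one (h : WeakBialgebra K A Δ ε) : piL K A Δ ε 1 = 1 := by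
  simpa [piL_eq, mulRight_one] using h.counit_left 1

theorem piR_one (h : WeakBialgebra K A Δ ε) : piR K A Δ ε 1 = 1 := by
  simpa [piR_eq, mulLeft_one] using h.counit_right 1

theorem counit_mul_piL (h : WeakBialgebra K A Δ ε) (z y : A) :
    ε (z * piL K A Δ ε y) = ε (z * y) := by
  have := h.weak_counit_b z 1 y
  rw [mul_one] at this
  rw [this, piL_eq]
  generalize Δ 1 = u
  induction u with
  | zero => simp
  | tmul a b => simp
  | add u v hu hv => simp only [mul_add, map_add, hu, hv]

theorem counit_piR_mul (h : WeakBialgebra K A Δ ε) (x z : A) :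
    ε (piR K A Δ ε x * z) = ε (x * z) := by
  have := h.weak_counit_b x 1 z
  rw [mul_one] at this
  rw [this, piR_eq]
  generalize Δ 1 = u
  induction u with
  | zero => simp
  | tmul a b => simp [mul_comm]
  | add u v hu hv => simp only [add_mul, map_add, hu, hv]

theorem counit_piBar_mul (h : WeakBialgebra K A Δ ε) (y z : A) :
    ε (piBar Δ ε y * z) = ε (y * z) := by
  have := h.weak_counit_a y 1 z
  rw [mul_one] at this
  rw [this, piBar_eq]
  generalize Δ 1 = u
  induction u with
  | zero => simp
  | tmul a b => simp
  | add u v hu hv => simp only [add_mul, map_add, hu, hv]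

theorem piL_mul_piL (h : WeakBialgebra K A Δ ε) (x y : A) :
    piL K A Δ ε (x * piL K A Δ ε y) = piL K A Δ ε (x * y) := by
  have key : ε ∘ₗ mulRight K (x * piL K A Δ ε y) = ε ∘ₗ mulRight K (x * y) := by
    ext z
    simp [h.counit_mul_piL]
  rw [piL_eq, key, ← piL_eq]

theorem piL_piL (h : WeakBialgebra K A Δ ε) (y : A) :
    piL K A Δ ε (piL K A Δ ε y) = piL K A Δ ε y := by
  simpa using h.piL_mul_piL 1 y

theorem piR_piR_mul (h : WeakBialgebra K A Δ ε) (x y : A) :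
    piR K A Δ ε (piR K A Δ ε x * y) = piR K A Δ ε (x * y) := by
  have key : ε ∘ₗ mulLeft K (piR K A Δ ε x * y) = ε ∘ₗ mulLeft K (x * y) := by
    ext z
    simp [h.counit_piR_mul]
  rw [piR_eq, key, ← piR_eq]

theorem piR_piBar (h : WeakBialgebra K A Δ ε) (y : A) :
    piR K A Δ ε (piBar Δ ε y) = piR K A Δ ε y := by
  have key : ε ∘ₗ mulLeft K (piBar Δ ε y) = ε ∘ₗ mulLeft K y := by
    ext z
    simp [h.counit_piBar_mul]
  rw [piR_eq, key, ← piR_eq]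

theorem comul_lid_rTensor (h : WeakBialgebra K A Δ ε) (f : A →ₗ[K] K) :
    Δ (TensorProduct.lid K A (f.rTensor A (Δ 1))) =
      Δ 1 * (TensorProduct.lid K A (f.rTensor A (Δ 1)) ⊗ₜ 1) := by
  have h1 : ∀ u : A ⊗[K] A, Δ (TensorProduct.lid K A (f.rTensor A u)) =
      TensorProduct.lid K (A ⊗[K] A) (f.rTensor (A ⊗[K] A) (Δ.lTensor A u)) := by
    intro u
    induction u with
    | zero => simp
    | tmul a b => simp
    | add u v hu hv => simp only [map_add, hu, hv]
  have h2 : ∀ u v : A ⊗[K] A, TensorProduct.lid K (A ⊗[K] A) (f.rTensor (A ⊗[K] A)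
      (TensorProduct.assoc K A A A
        ((TensorProduct.assoc K A A A).symm ((1 : A) ⊗ₜ[K] v) * (u ⊗ₜ[K] (1 : A))))) =
      v * (TensorProduct.lid K A (f.rTensor A u) ⊗ₜ 1) := by
    intro u v
    induction u with
    | zero => simp
    | add u u' hu hu' => simp only [map_add, mul_add, TensorProduct.add_tmul, hu, hu']
    | tmul a b =>
      induction v with
      | zero => simp
      | add v v' hv hv' => simp only [map_add, add_mul, TensorProduct.tmul_add, hv, hv']
      | tmul c d => simp [TensorProduct.smul_tmul']
  rw [h1, ← h.coassoc, h.weak_comul_unit_b, h2]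

theorem comul_rid_lTensor (h : WeakBialgebra K A Δ ε) (f : A →ₗ[K] K) :
    Δ (TensorProduct.rid K A (f.lTensor A (Δ 1))) =
      (1 ⊗ₜ TensorProduct.rid K A (f.lTensor A (Δ 1))) * Δ 1 := by
  have h1 : ∀ u : A ⊗[K] A, Δ (TensorProduct.rid K A (f.lTensor A u)) =
      TensorProduct.rid K (A ⊗[K] A) (f.lTensor (A ⊗[K] A) (Δ.rTensor A u)) := by
    intro u
    induction u with
    | zero => simp
    | tmul a b => simp
    | add u v hu hv => simp only [map_add, hu, hv]
  have h2 : ∀ u v : A ⊗[K] A, TensorProduct.rid K (A ⊗[K] A) (f.lTensor (A ⊗[K] A)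
        ((TensorProduct.assoc K A A A).symm ((1 : A) ⊗ₜ[K] v) * (u ⊗ₜ[K] (1 : A)))) =
      (1 ⊗ₜ TensorProduct.rid K A (f.lTensor A v)) * u := by
    intro u v
    induction u with
    | zero => simp
    | add u u' hu hu' => simp only [map_add, mul_add, TensorProduct.add_tmul, hu, hu']
    | tmul a b =>
      induction v with
      | zero => simp
      | add v v' hv hv' => simp only [map_add, add_mul, TensorProduct.tmul_add, hv, hv']
      | tmul c d => simp
  rw [h1, h.weak_comul_unit_b, h2]

theorem comul_mul_piL (h : WeakBialgebra K A Δ ε) (x y : A) :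
    Δ (x * piL K A Δ ε y) = Δ x * (piL K A Δ ε y ⊗ₜ 1) := by
  rw [h.comul_mul, piL_eq, h.comul_lid_rTensor, ← mul_assoc, h.comul_mul_one]

theorem comul_piR_mul (h : WeakBialgebra K A Δ ε) (x y : A) :
    Δ (piR K A Δ ε x * y) = (1 ⊗ₜ piR K A Δ ε x) * Δ y := by
  rw [h.comul_mul, piR_eq, h.comul_rid_lTensor, mul_assoc, h.comul_one_mul]

theorem piL_mul_piR_comm (h : WeakBialgebra K A Δ ε) (x y : A) :
    piL K A Δ ε y * piR K A Δ ε x = piR K A Δ ε x * piL K A Δ ε y := by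
  rw [piL_eq, piR_eq]
  generalize ε ∘ₗ mulRight K y = f
  generalize ε ∘ₗ mulLeft K x = g
  have e := h.weak_comul_unit_a.symm.trans h.weak_comul_unit_b
  have e' := congrArg (fun t => TensorProduct.rid K A (g.lTensor A
    (((TensorProduct.lid K A).toLinearMap ∘ₗ f.rTensor A).rTensor A t))) e
  have h1 : ∀ u v : A ⊗[K] A, TensorProduct.rid K A (g.lTensor A
    (((TensorProduct.lid K A).toLinearMap ∘ₗ f.rTensor A).rTensor A
      ((u ⊗ₜ[K] (1 : A)) * (TensorProduct.assoc K A A A).symm ((1 : A) ⊗ₜ[K] v)))) =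
      TensorProduct.lid K A (f.rTensor A u) * TensorProduct.rid K A (g.lTensor A v) := by
    intro u v
    induction u with
    | zero => simp
    | add u u' hu hu' => simp only [map_add, add_mul, TensorProduct.add_tmul, hu, hu']
    | tmul a b =>
      induction v with
      | zero => simp
      | add v v' hv hv' => simp only [map_add, mul_add, TensorProduct.tmul_add, hv, hv']
      | tmul c d => simp [smul_smul, mul_comm]
  have h2 : ∀ u v : A ⊗[K] A, TensorProduct.rid K A (g.lTensor A
    (((TensorProduct.lid K A).toLinearMap ∘ₗ f.rTensor A).rTensor A
      ((TensorProduct.assoc K A A A).symm ((1 : A) ⊗ₜ[K] v) * (u ⊗ₜ[K] (1 : A))))) =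
      TensorProduct.rid K A (g.lTensor A v) * TensorProduct.lid K A (f.rTensor A u) := by
    intro u v
    induction u with
    | zero => simp
    | add u u' hu hu' => simp only [map_add, mul_add, TensorProduct.add_tmul, hu, hu']
    | tmul a b =>
      induction v with
      | zero => simp
      | add v v' hv hv' => simp only [map_add, add_mul, TensorProduct.tmul_add, hv, hv']
      | tmul c d => simp [smul_smul, mul_comm]
  simpa only [h1, h2] using e'

theorem lTensor_piL_comul (h : WeakBialgebra K A Δ ε) (x : A) :
    (piL K A Δ ε).lTensor A (Δ x) = Δ 1 * (x ⊗ₜ 1) := by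
  set M := ((TensorProduct.rid K A).toLinearMap ∘ₗ ε.lTensor A).rTensor A with hM
  have h0 : ∀ w, M (Δ.rTensor A w) = w := by
    intro w
    induction w with
    | zero => simp
    | tmul a b => simp [hM, h.counit_right]
    | add u v hu hv => simp only [map_add, hu, hv]
  have h1 : ∀ w, Δ.rTensor A (w * (x ⊗ₜ 1)) = Δ.rTensor A w * (Δ x ⊗ₜ 1) := by
    intro w
    induction w with
    | zero => simp
    | tmul a b => simp [h.comul_mul]
    | add u v hu hv => simp only [map_add, add_mul, hu, hv]
  have h2 : ∀ u v : A ⊗[K] A,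
      M ((TensorProduct.assoc K A A A).symm ((1 : A) ⊗ₜ[K] v) * (u ⊗ₜ[K] (1 : A))) =
      ((TensorProduct.lid K A).toLinearMap ∘ₗ ε.rTensor A ∘ₗ
        mulLeft K v ∘ₗ (TensorProduct.mk K A A).flip 1).lTensor A u := by
    intro u v
    induction u with
    | zero => simp
    | add u u' hu hu' => simp only [map_add, mul_add, TensorProduct.add_tmul, hu, hu']
    | tmul a b =>
      induction v with
      | zero => simp
      | add v v' hv hv' =>
        simp only [TensorProduct.tmul_add, map_add, add_mul, hv, hv']
        simp [add_mul, TensorProduct.tmul_add]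
      | tmul c d => simp [hM, TensorProduct.smul_tmul']
  rw [← h0 (Δ 1 * _), h1, h.weak_comul_unit_b, mul_assoc, Algebra.TensorProduct.tmul_mul_tmul,
    h.comul_one_mul, mul_one, h2]
  rfl

theorem lTensor_piBar_comul (h : WeakBialgebra K A Δ ε) (x : A) :
    (piBar Δ ε).lTensor A (Δ x) = (x ⊗ₜ 1) * Δ 1 := by
  set M := ((TensorProduct.rid K A).toLinearMap ∘ₗ ε.lTensor A).rTensor A with hM
  have h0 : ∀ w, M (Δ.rTensor A w) = w := by
    intro w
    induction w with
    | zero => simp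
    | tmul a b => simp [hM, h.counit_right]
    | add u v hu hv => simp only [map_add, hu, hv]
  have h1 : ∀ w, Δ.rTensor A ((x ⊗ₜ 1) * w) = (Δ x ⊗ₜ 1) * Δ.rTensor A w := by
    intro w
    induction w with
    | zero => simp
    | tmul a b => simp [h.comul_mul]
    | add u v hu hv => simp only [map_add, mul_add, hu, hv]
  have h2 : ∀ u v : A ⊗[K] A,
      M ((u ⊗ₜ[K] (1 : A)) * (TensorProduct.assoc K A A A).symm ((1 : A) ⊗ₜ[K] v)) =
      ((TensorProduct.lid K A).toLinearMap ∘ₗ ε.rTensor A ∘ₗ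
        mulRight K v ∘ₗ (TensorProduct.mk K A A).flip 1).lTensor A u := by
    intro u v
    induction u with
    | zero => simp
    | add u u' hu hu' => simp only [map_add, add_mul, TensorProduct.add_tmul, hu, hu']
    | tmul a b =>
      induction v with
      | zero => simp
      | add v v' hv hv' =>
        simp only [TensorProduct.tmul_add, map_add, mul_add, hv, hv']
        simp [mul_add, TensorProduct.tmul_add]
      | tmul c d => simp [hM, TensorProduct.smul_tmul']
  rw [← h0 (_ * Δ 1), h1, h.weak_comul_unit_a, ← mul_assoc, Algebra.TensorProduct.tmul_mul_tmul,
    h.comul_mul_one, mul_one, h2]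
  rfl

end

end WeakBialgebra

namespace WeakHopfAlgebra

open LinearMap WithConv

section

variable {K A} {Δ : A →ₗ[K] A ⊗[K] A} {ε : A →ₗ[K] K} {S : A →ₗ[K] A}

theorem mul'_map_smul_right (f g : A →ₗ[K] A) (c : A →ₗ[K] K) (u : A ⊗[K] A) (z : A)
    (hg : ∀ x, g x = c x • z) :
    mul' K A (TensorProduct.map f g u) = f (TensorProduct.rid K A (c.lTensor A u)) * z := by
  induction u with
  | zero => simp
  | tmul a b => simp [hg]
  | add u v hu hv => simp only [map_add, add_mul, hu, hv]

theorem conv_ext {F G : WithConv (A ⊗[K] A →ₗ[K] A)}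
    (h : ∀ x y : A, F (x ⊗ₜ[K] y) = G (x ⊗ₜ[K] y)) : F = G :=
  WithConv.ext (TensorProduct.ext' h)

section Convolution

variable [Coalgebra K A]

/-- The extension of `f` to `A ⊗ A` by the counit on the second factor. -/
def extendLeft (f : A →ₗ[K] A) : WithConv (A ⊗[K] A →ₗ[K] A) :=
  toConv (f ∘ₗ (TensorProduct.rid K A).toLinearMap ∘ₗ Coalgebra.counit.lTensor A)

/-- The extension of `f` to `A ⊗ A` by the counit on the first factor. -/
def extendRight (f : A →ₗ[K] A) : WithConv (A ⊗[K] A →ₗ[K] A) :=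
  toConv (f ∘ₗ (TensorProduct.lid K A).toLinearMap ∘ₗ Coalgebra.counit.rTensor A)

theorem extendLeft_tmul (f : A →ₗ[K] A) (x y : A) :
    extendLeft f (x ⊗ₜ[K] y) = Coalgebra.counit (R := K) y • f x := by
  simp [extendLeft]

theorem extendRight_tmul (f : A →ₗ[K] A) (x y : A) :
    extendRight f (x ⊗ₜ[K] y) = Coalgebra.counit (R := K) x • f y := by
  simp [extendRight]

theorem extendLeft_convMul_tmul (f : A →ₗ[K] A) (k : WithConv (A ⊗[K] A →ₗ[K] A)) (x y : A) :
    (extendLeft f * k) (x ⊗ₜ[K] y) =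
      mul' K A (TensorProduct.map f (k.ofConv ∘ₗ (TensorProduct.mk K A A).flip y)
        (Coalgebra.comul x)) := by
  have key : ∀ u v : A ⊗[K] A, mul' K A (TensorProduct.map (extendLeft f).ofConv k.ofConv
      (TensorProduct.tensorTensorTensorComm K A A A A (u ⊗ₜ v))) =
      mul' K A (TensorProduct.map f (k.ofConv ∘ₗ (TensorProduct.mk K A A).flip
        (TensorProduct.lid K A (Coalgebra.counit.rTensor A v))) u) := by
    intro u v
    induction u with
    | zero => simp
    | add u u' hu hu' => simp only [map_add, TensorProduct.add_tmul, hu, hu']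
    | tmul a b =>
      induction v with
      | zero => simp
      | add v v' hv hv' =>
        simp only [map_add, TensorProduct.tmul_add, hv, hv']
        simp [TensorProduct.tmul_add]
      | tmul c d => simp [extendLeft_tmul]
  have := key (Coalgebra.comul x) (Coalgebra.comul y)
  rw [Coalgebra.rTensor_counit_comul, TensorProduct.lid_tmul, one_smul] at this
  exact this

theorem extendRight_convMul_tmul (f : A →ₗ[K] A) (k : WithConv (A ⊗[K] A →ₗ[K] A)) (x y : A) :
    (extendRight f * k) (x ⊗ₜ[K] y) =
      mul' K A (TensorProduct.map f (k.ofConv ∘ₗ TensorProduct.mk K A A x)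
        (Coalgebra.comul y)) := by
  have key : ∀ u v : A ⊗[K] A, mul' K A (TensorProduct.map (extendRight f).ofConv k.ofConv
      (TensorProduct.tensorTensorTensorComm K A A A A (u ⊗ₜ v))) =
      mul' K A (TensorProduct.map f (k.ofConv ∘ₗ TensorProduct.mk K A A
        (TensorProduct.lid K A (Coalgebra.counit.rTensor A u))) v) := by
    intro u v
    induction v with
    | zero => simp
    | add v v' hv hv' => simp only [map_add, TensorProduct.tmul_add, hv, hv']
    | tmul c d =>
      induction u with
      | zero => simp
      | add u u' hu hu' =>
        simp only [map_add, TensorProduct.add_tmul, hu, hu']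
        simp [mul_add]
      | tmul a b => simp [extendRight_tmul]
  have := key (Coalgebra.comul x) (Coalgebra.comul y)
  rw [Coalgebra.rTensor_counit_comul, TensorProduct.lid_tmul, one_smul] at this
  exact this

theorem extendLeft_mul_extendRight_tmul (f g : A →ₗ[K] A) (x y : A) :
    (extendLeft f * extendRight g) (x ⊗ₜ[K] y) = f x * g y := by
  rw [extendLeft_convMul_tmul, mul'_map_smul_right f _ Coalgebra.counit _ (g y)
    (fun z => by simp [extendRight_tmul])]
  simp

theorem extendRight_mul_extendLeft_tmul (f g : A →ₗ[K] A) (x y : A) :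
    (extendRight f * extendLeft g) (x ⊗ₜ[K] y) = f y * g x := by
  rw [extendRight_convMul_tmul, mul'_map_smul_right f _ Coalgebra.counit _ (g x)
    (fun z => by simp [extendLeft_tmul])]
  simp

theorem extendLeft_mul_extendLeft (f g : A →ₗ[K] A) :
    extendLeft f * extendLeft g = extendLeft (toConv f * toConv g).ofConv := by
  refine conv_ext fun x y => ?_
  refine (extendLeft_convMul_tmul _ _ _ _).trans (Eq.trans ?_ (extendLeft_tmul _ _ _).symm)
  rw [convMul_apply]
  generalize (Coalgebra.comul x : A ⊗[K] A) = u
  induction u with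
  | zero => simp
  | tmul a b => simp [extendLeft_tmul]
  | add u v hu hv => simp only [map_add, smul_add, hu, hv]

theorem extendRight_mul_extendRight (f g : A →ₗ[K] A) :
    extendRight f * extendRight g = extendRight (toConv f * toConv g).ofConv := by
  refine conv_ext fun x y => ?_
  refine (extendRight_convMul_tmul _ _ _ _).trans (Eq.trans ?_ (extendRight_tmul _ _ _).symm)
  rw [convMul_apply]
  generalize (Coalgebra.comul y : A ⊗[K] A) = u
  induction u with
  | zero => simp
  | tmul a b => simp [extendRight_tmul]
  | add u v hu hv => simp only [map_add, smul_add, hu, hv]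

theorem convMul_comp_mul'
    (hmul : ∀ x y : A, Coalgebra.comul (R := K) (x * y) = Coalgebra.comul x * Coalgebra.comul y)
    (f g : A →ₗ[K] A) :
    toConv (f ∘ₗ mul' K A) * toConv (g ∘ₗ mul' K A) =
      toConv ((toConv f * toConv g).ofConv ∘ₗ mul' K A) := by
  refine conv_ext fun x y => ?_
  have key : ∀ u v : A ⊗[K] A, mul' K A (TensorProduct.map (f ∘ₗ mul' K A) (g ∘ₗ mul' K A)
      (TensorProduct.tensorTensorTensorComm K A A A A (u ⊗ₜ v))) =
      mul' K A (TensorProduct.map f g (u * v)) := by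
    intro u v
    induction u with
    | zero => simp
    | add u u' hu hu' => simp only [map_add, TensorProduct.add_tmul, add_mul, hu, hu']
    | tmul a b =>
      induction v with
      | zero => simp
      | add v v' hv hv' => simp only [map_add, TensorProduct.tmul_add, mul_add, hv, hv']
      | tmul c d => simp
  refine (key (Coalgebra.comul x) (Coalgebra.comul y)).trans ?_
  simp [LinearMap.convMul_def, hmul]

end Convolution

theorem antipode_mul (h : WeakHopfAlgebra K A Δ ε S) (x y : A) : S (x * y) = S y * S x := by
  have hW := h.toWeakBialgebra
  let _ : Coalgebra K A := hW.toCoalgebra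
  have hL : toConv (LinearMap.id : A →ₗ[K] A) * toConv S = toConv (piL K A Δ ε) := by
    ext a
    exact h.antipode_a a
  have hR : toConv S * toConv (LinearMap.id : A →ₗ[K] A) = toConv (piR K A Δ ε) := by
    ext a
    exact h.antipode_b a
  have hS : toConv S * toConv (LinearMap.id : A →ₗ[K] A) * toConv S = toConv S := by
    rw [mul_assoc]
    ext a
    refine Eq.trans ?_ (h.antipode_c a)
    change mul' K A (TensorProduct.map S
      (mul' K A ∘ₗ TensorProduct.map LinearMap.id S ∘ₗ Δ) (Δ a)) = _
    exact congrArg (mul' K A) (LinearMap.congr_fun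
      (map_comp_lTensor (f := S) (g := mul' K A ∘ₗ S.lTensor A) (g' := Δ)).symm (Δ a))
  set H : WithConv (A ⊗[K] A →ₗ[K] A) := toConv (LinearMap.id ∘ₗ mul' K A) with hH
  set F : WithConv (A ⊗[K] A →ₗ[K] A) := toConv (S ∘ₗ mul' K A) with hF
  set G := extendRight S * extendLeft S with hG
  have hH' : H = extendLeft LinearMap.id * extendRight LinearMap.id := by
    refine conv_ext fun a b => ?_
    exact (extendLeft_mul_extendRight_tmul (K := K) LinearMap.id LinearMap.id a b).symm
  have hFH : F * H = toConv (piR K A Δ ε ∘ₗ mul' K A) := by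
    rw [hF, hH, convMul_comp_mul' hW.comul_mul, hR]
  have hHF : H * F = toConv (piL K A Δ ε ∘ₗ mul' K A) := by
    rw [hF, hH, convMul_comp_mul' hW.comul_mul, hL]
  have hFHF : F * H * F = F := by
    rw [hFH, hF, convMul_comp_mul' hW.comul_mul, ← hR, toConv_ofConv, hS]
  have hGH : G * H = toConv (piR K A Δ ε ∘ₗ mul' K A) := by
    have e : G * H = extendRight S * (extendLeft (piR K A Δ ε) * extendRight LinearMap.id) := by
      rw [← ofConv_toConv (piR K A Δ ε), ← hR, ← extendLeft_mul_extendLeft, hG, hH']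
      simp only [mul_assoc]
    rw [e]
    refine conv_ext fun a b => ?_
    refine (extendRight_convMul_tmul _ _ _ _).trans ?_
    have e2 : (extendLeft (piR K A Δ ε) * extendRight LinearMap.id).ofConv ∘ₗ
        TensorProduct.mk K A A a = mulLeft K (piR K A Δ ε a) := by
      ext c
      exact extendLeft_mul_extendRight_tmul _ _ _ _
    rw [e2]
    change _ = piR K A Δ ε (a * b)
    rw [← hW.piR_piR_mul, ← h.antipode_b (_ * b), hW.comul_piR_mul]
    change mul' K A (TensorProduct.map _ _ (Δ b)) = _
    generalize Δ b = u
    induction u with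
    | zero => simp
    | tmul a b => simp
    | add u v hu hv => simp only [map_add, mul_add, hu, hv]
  have hHG : H * G = toConv (piL K A Δ ε ∘ₗ mul' K A) := by
    have e : H * G = extendLeft LinearMap.id * (extendRight (piL K A Δ ε) * extendLeft S) := by
      rw [← ofConv_toConv (piL K A Δ ε), ← hL, ← extendRight_mul_extendRight, hG, hH']
      simp only [mul_assoc]
    rw [e]
    refine conv_ext fun a b => ?_
    refine (extendLeft_convMul_tmul _ _ _ _).trans ?_
    have e2 : (extendRight (piL K A Δ ε) * extendLeft S).ofConv ∘ₗ
        (TensorProduct.mk K A A).flip b = mulLeft K (piL K A Δ ε b) ∘ₗ S := by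
      ext c
      exact extendRight_mul_extendLeft_tmul _ _ _ _
    rw [e2]
    change _ = piL K A Δ ε (a * b)
    rw [← hW.piL_mul_piL, ← h.antipode_a (a * _), hW.comul_mul_piL]
    change mul' K A (TensorProduct.map _ _ (Δ a)) = _
    generalize Δ a = u
    induction u with
    | zero => simp
    | tmul a b => simp [mul_assoc]
    | add u v hu hv => simp only [map_add, add_mul, hu, hv]
  have hcomm : extendLeft (piR K A Δ ε) * extendRight (piL K A Δ ε) =
      extendRight (piL K A Δ ε) * extendLeft (piR K A Δ ε) := by
    refine conv_ext fun a b => ?_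
    exact (extendLeft_mul_extendRight_tmul _ _ _ _).trans
      ((hW.piL_mul_piR_comm a b).symm.trans (extendRight_mul_extendLeft_tmul _ _ _ _).symm)
  have hGHG : G * H * G = G := by
    calc G * H * G
        = extendRight S * (extendLeft S * extendLeft LinearMap.id) *
            (extendRight LinearMap.id * extendRight S) * extendLeft S := by
          rw [hG, hH']; simp only [mul_assoc]
      _ = extendRight S * (extendLeft (piR K A Δ ε) * extendRight (piL K A Δ ε)) *
            extendLeft S := by
          rw [extendLeft_mul_extendLeft, extendRight_mul_extendRight, hL, hR]
          simp only [mul_assoc]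
      _ = (extendRight S * extendRight (piL K A Δ ε)) *
            (extendLeft (piR K A Δ ε) * extendLeft S) := by
          rw [hcomm]; simp only [mul_assoc]
      _ = G := by
          rw [extendLeft_mul_extendLeft, extendRight_mul_extendRight, ← hL, ← hR, hS,
            ← mul_assoc, hS]
  have hFG : F = G := by
    rw [← hFHF, mul_assoc, hHF, ← hHG, ← mul_assoc, hFH, ← hGH, hGHG]
  have := congrArg (fun k : WithConv (A ⊗[K] A →ₗ[K] A) => k (x ⊗ₜ y)) hFG
  exact this.trans (extendRight_mul_extendLeft_tmul _ _ _ _)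

theorem antipode_piBar (h : WeakHopfAlgebra K A Δ ε S) :
    S ∘ₗ WeakBialgebra.piBar Δ ε = piR K A Δ ε := by
  ext y
  have hW := h.toWeakBialgebra
  rw [LinearMap.comp_apply, ← hW.piR_piBar, ← h.antipode_b (WeakBialgebra.piBar Δ ε y),
    WeakBialgebra.piBar_eq, hW.comul_lid_rTensor]
  generalize TensorProduct.lid K A _ = l
  have key : ∀ u : A ⊗[K] A, mul' K A (S.rTensor A (u * (l ⊗ₜ 1))) =
      S l * mul' K A (S.rTensor A u) := by
    intro u
    induction u with
    | zero => simp
    | tmul a b => simp [h.antipode_mul, mul_assoc]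
    | add u v hu hv => simp only [map_add, add_mul, mul_add, hu, hv]
  rw [key, h.antipode_b, hW.piR_one, mul_one]

theorem lTensor_piR_comul (h : WeakHopfAlgebra K A Δ ε S) (x : A) :
    (piR K A Δ ε).lTensor A (Δ x) = S.lTensor A ((x ⊗ₜ 1) * Δ 1) := by
  rw [← h.antipode_piBar, lTensor_comp, LinearMap.comp_apply,
    h.toWeakBialgebra.lTensor_piBar_comul]

/-- The identity `Σ x₍₁₎ a₍₁₎ ⊗ S(x₍₂₎ a₍₂₎) x₍₃₎ = Σ x a₍₁₎ ⊗ S(a₍₂₎)`. -/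
theorem comul_mul_antipode_cancel (h : WeakHopfAlgebra K A Δ ε S) (x a : A) :
    (mul' K A ∘ₗ S.rTensor A).lTensor A
      (TensorProduct.assoc K A A A (Δ.rTensor A (Δ x) * (Δ a ⊗ₜ 1))) =
      S.lTensor A ((x ⊗ₜ 1) * Δ a) := by
  have hW := h.toWeakBialgebra
  have key : ∀ w : A ⊗[K] A, (mul' K A ∘ₗ S.rTensor A).lTensor A
      (TensorProduct.assoc K A A A (Δ.rTensor A (Δ x) * (w ⊗ₜ 1))) =
      S.lTensor A ((x ⊗ₜ 1) * Δ 1 * w) := by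
    intro w
    induction w with
    | zero => simp
    | add u v hu hv => simp only [TensorProduct.add_tmul, map_add, mul_add, hu, hv]
    | tmul c d =>
      have h1 : ∀ t : A ⊗[K] (A ⊗[K] A), (mul' K A ∘ₗ S.rTensor A).lTensor A
          (TensorProduct.assoc K A A A
            ((TensorProduct.assoc K A A A).symm t * ((c ⊗ₜ d) ⊗ₜ 1))) =
          TensorProduct.map (mulRight K c) (mulLeft K (S d))
            ((mul' K A ∘ₗ S.rTensor A).lTensor A t) := by
        intro t
        induction t with
        | zero => simp
        | add u v hu hv => simp only [map_add, add_mul, hu, hv]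
        | tmul p t =>
          induction t with
          | zero => simp
          | add u v hu hv => simp only [TensorProduct.tmul_add, map_add, add_mul, hu, hv]
          | tmul r q => simp [h.antipode_mul, mul_assoc]
      have h2 : ∀ u : A ⊗[K] A, TensorProduct.map (mulRight K c) (mulLeft K (S d))
          (S.lTensor A u) = S.lTensor A (u * (c ⊗ₜ d)) := by
        intro u
        induction u with
        | zero => simp
        | add u v hu hv => simp only [map_add, add_mul, hu, hv]
        | tmul p q => simp [h.antipode_mul]
      have h3 : (mul' K A ∘ₗ S.rTensor A) ∘ₗ Δ = piR K A Δ ε := LinearMap.ext h.antipode_b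
      rw [← (TensorProduct.assoc K A A A).symm_apply_apply (Δ.rTensor A (Δ x)), hW.coassoc, h1,
        ← LinearMap.comp_apply (lTensor A _), ← lTensor_comp, h3, h.lTensor_piR_comul, h2]
  rw [key, mul_assoc, hW.comul_one_mul]

variable {ι : Type*} [Fintype ι] (b : Module.Basis ι K A)

/-- The projection `m ↦ Σᵢ βᵢ(S²((bᵢ m)₍₂₎)) (bᵢ m)₍₁₎` onto the left integrals, where `β` is the
basis dual to `b`. -/
def integralProj (Δ : A →ₗ[K] A ⊗[K] A) (S : A →ₗ[K] A) (m : A) : A :=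
  ∑ i, TensorProduct.rid K A ((b.coord i ∘ₗ S ∘ₗ S).lTensor A (Δ (b i * m)))

theorem sum_coord_mulLeft {M : Type*} [AddCommGroup M] [Module K M]
    (B : (A →ₗ[K] K) →ₗ[K] A →ₗ[K] M) (z : A) :
    ∑ i, B (b.coord i ∘ₗ mulLeft K z) (b i) = ∑ i, B (b.coord i) (z * b i) := by
  classical
  have h1 : ∀ f : A →ₗ[K] K, f = ∑ j, f (b j) • b.coord j := by
    intro f
    refine b.ext fun k => ?_
    simp
  calc ∑ i, B (b.coord i ∘ₗ mulLeft K z) (b i)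
      = ∑ i, ∑ j, b.coord i (z * b j) • B (b.coord j) (b i) := by
        refine Finset.sum_congr rfl fun i _ => ?_
        conv_lhs => rw [h1 (b.coord i ∘ₗ mulLeft K z)]
        simp
    _ = ∑ j, B (b.coord j) (∑ i, b.coord i (z * b j) • b i) := by
        rw [Finset.sum_comm]
        simp only [map_sum, map_smul]
    _ = _ := by simp only [Module.Basis.coord_apply, b.sum_repr]

theorem mul_integralProj (h : WeakHopfAlgebra K A Δ ε S) (x m : A) :
    x * integralProj b Δ S m = ∑ i, TensorProduct.rid K A
      ((b.coord i ∘ₗ S ∘ₗ S).lTensor A (Δ (piL K A Δ ε x * b i * m))) := by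
  have h1 : ∀ (f : A →ₗ[K] K) (w : A ⊗[K] A), x * TensorProduct.rid K A ((f ∘ₗ S).lTensor A w) =
      TensorProduct.rid K A (f.lTensor A (S.lTensor A ((x ⊗ₜ 1) * w))) := by
    intro f w
    induction w with
    | zero => simp
    | tmul a b => simp
    | add u v hu hv => simp only [map_add, mul_add, hu, hv]
  have h2 : ∀ (f : A →ₗ[K] K) (q : A) (w : A ⊗[K] A), TensorProduct.rid K A ((f ∘ₗ S).lTensor A
      ((mul' K A ∘ₗ S.rTensor A).lTensor A (TensorProduct.assoc K A A A (w ⊗ₜ q)))) =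
      TensorProduct.rid K A (((f ∘ₗ mulLeft K (S q)) ∘ₗ S ∘ₗ S).lTensor A w) := by
    intro f q w
    induction w with
    | zero => simp
    | tmul a b => simp [h.antipode_mul]
    | add u v hu hv => simp only [TensorProduct.add_tmul, map_add, hu, hv]
  have h3 : ∀ u : A ⊗[K] A, ∑ i, TensorProduct.rid K A ((b.coord i ∘ₗ S).lTensor A
      ((mul' K A ∘ₗ S.rTensor A).lTensor A
        (TensorProduct.assoc K A A A (Δ.rTensor A u * (Δ (b i * m) ⊗ₜ 1))))) =
      ∑ i, TensorProduct.rid K A ((b.coord i ∘ₗ S ∘ₗ S).lTensor A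
        (Δ (mul' K A (S.lTensor A u) * b i * m))) := by
    intro u
    induction u with
    | zero => simp
    | add u v hu hv => simp only [map_add, add_mul, Finset.sum_add_distrib, hu, hv]
    | tmul p q =>
      let B : (A →ₗ[K] K) →ₗ[K] A →ₗ[K] A := LinearMap.mk₂ K
        (fun f a => TensorProduct.rid K A ((f ∘ₗ S ∘ₗ S).lTensor A (Δ (p * (a * m)))))
        (fun f g a => by simp [add_comp, lTensor_add])
        (fun c f a => by simp [smul_comp, lTensor_smul])
        (fun f a a' => by simp [add_mul, mul_add])
        (fun c f a => by simp)
      have := sum_coord_mulLeft b B (S q)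
      simp only [rTensor_tmul, Algebra.TensorProduct.tmul_mul_tmul, mul_one, h2,
        ← h.toWeakBialgebra.comul_mul]
      simpa [B, mul_assoc] using this
  rw [← h.antipode_a, ← h3, integralProj, Finset.mul_sum]
  refine Finset.sum_congr rfl fun i _ => ?_
  rw [h.comul_mul_antipode_cancel, ← h1]
  rfl

theorem mul_integralProj_eq_piL_mul (h : WeakHopfAlgebra K A Δ ε S) (x m : A) :
    x * integralProj b Δ S m = piL K A Δ ε x * integralProj b Δ S m := by
  rw [h.mul_integralProj, h.mul_integralProj, h.toWeakBialgebra.piL_piL]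

/-- Every element is recovered from the left integrals by the action of the dual. -/
theorem sum_integralProj (h : WeakHopfAlgebra K A Δ ε S) (m : A) :
    ∑ i, TensorProduct.rid K A ((b.coord i ∘ₗ S).lTensor A (Δ (integralProj b Δ S (b i * m)))) =
      m := by
  have hW := h.toWeakBialgebra
  have h1 : ∀ (f g : A →ₗ[K] K) (a : A),
      TensorProduct.rid K A (f.lTensor A (Δ (TensorProduct.rid K A (g.lTensor A (Δ a))))) =
      TensorProduct.rid K A ((mul' K K ∘ₗ TensorProduct.map f g ∘ₗ Δ).lTensor A (Δ a)) := by
    intro f g a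
    have e1 : ∀ u : A ⊗[K] A, Δ (TensorProduct.rid K A (g.lTensor A u)) =
        TensorProduct.rid K (A ⊗[K] A) (g.lTensor (A ⊗[K] A) (Δ.rTensor A u)) := by
      intro u
      induction u with
      | zero => simp
      | tmul a b => simp
      | add u v hu hv => simp only [map_add, hu, hv]
    have e2 : ∀ t : A ⊗[K] (A ⊗[K] A), TensorProduct.rid K A (f.lTensor A
        (TensorProduct.rid K (A ⊗[K] A) (g.lTensor (A ⊗[K] A)
          ((TensorProduct.assoc K A A A).symm t)))) =
        TensorProduct.rid K A ((mul' K K ∘ₗ TensorProduct.map f g).lTensor A t) := by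
      intro t
      induction t with
      | zero => simp
      | add u v hu hv => simp only [map_add, hu, hv]
      | tmul p t =>
        induction t with
        | zero => simp
        | add u v hu hv => simp only [TensorProduct.tmul_add, map_add, hu, hv]
        | tmul r q => simp [smul_smul, mul_comm]
    rw [e1, ← (TensorProduct.assoc K A A A).symm_apply_apply (Δ.rTensor A (Δ a)), hW.coassoc, e2,
      ← LinearMap.comp_apply (lTensor A _), ← lTensor_comp, LinearMap.comp_assoc]
  have h2 : ∀ (k : ι), ∑ i, ∑ j, b.coord k (b j * b i) •
      (mul' K K ∘ₗ TensorProduct.map (b.coord i ∘ₗ S) (b.coord j ∘ₗ S ∘ₗ S) ∘ₗ Δ) =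
      b.coord k ∘ₗ S ∘ₗ piL K A Δ ε := by
    intro k
    ext c
    rw [LinearMap.comp_apply, LinearMap.comp_apply, ← h.antipode_a]
    simp only [LinearMap.sum_apply, LinearMap.smul_apply, LinearMap.comp_apply]
    generalize Δ c = u
    induction u with
    | zero => simp
    | add u v hu hv => simp only [map_add, smul_add, Finset.sum_add_distrib, hu, hv]
    | tmul p q =>
      simp only [TensorProduct.map_tmul, mul'_apply, LinearMap.comp_apply, lTensor_tmul,
        h.antipode_mul]
      conv_rhs => rw [← b.sum_repr (S (S q)), ← b.sum_repr (S p)]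
      simp only [Finset.sum_mul, Finset.mul_sum, map_sum, smul_mul_assoc, mul_smul_comm, map_smul,
        smul_eq_mul, Module.Basis.coord_apply]
      refine Finset.sum_congr rfl fun i _ => Finset.sum_congr rfl fun j _ => ?_
      ring
  have h3 : ∀ u : A ⊗[K] A, ∑ k, TensorProduct.rid K A ((b.coord k ∘ₗ S).lTensor A
      (u * ((b k * m) ⊗ₜ 1))) = mul' K A (S.lTensor A u) * m := by
    intro u
    induction u with
    | zero => simp
    | add u v hu hv => simp only [map_add, add_mul, Finset.sum_add_distrib, hu, hv]
    | tmul p q =>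
      simp only [lTensor_tmul, mul'_apply]
      conv_rhs => rw [← b.sum_repr (S q)]
      simp only [Finset.mul_sum, Finset.sum_mul, mul_smul_comm, smul_mul_assoc, mul_assoc]
      simp
  calc _ = ∑ i, ∑ j, TensorProduct.rid K A ((mul' K K ∘ₗ TensorProduct.map (b.coord i ∘ₗ S)
            (b.coord j ∘ₗ S ∘ₗ S) ∘ₗ Δ).lTensor A (Δ (b j * b i * m))) := by
        simp only [integralProj, map_sum, h1, mul_assoc]
    _ = ∑ i, ∑ j, ∑ k, TensorProduct.rid K A ((b.coord k (b j * b i) •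
            (mul' K K ∘ₗ TensorProduct.map (b.coord i ∘ₗ S)
            (b.coord j ∘ₗ S ∘ₗ S) ∘ₗ Δ)).lTensor A (Δ (b k * m))) := by
        refine Finset.sum_congr rfl fun i _ => Finset.sum_congr rfl fun j _ => ?_
        conv_lhs => rw [← b.sum_repr (b j * b i)]
        simp only [Finset.sum_mul, map_sum, smul_mul_assoc, map_smul, lTensor_smul,
          LinearMap.smul_apply, Module.Basis.coord_apply]
    _ = ∑ k, TensorProduct.rid K A ((∑ i, ∑ j, b.coord k (b j * b i) •
            (mul' K K ∘ₗ TensorProduct.map (b.coord i ∘ₗ S)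
            (b.coord j ∘ₗ S ∘ₗ S) ∘ₗ Δ)).lTensor A (Δ (b k * m))) := by
        simp only [← coe_lTensorHom, map_sum, LinearMap.sum_apply]
        exact (Finset.sum_congr rfl fun i _ => Finset.sum_comm).trans Finset.sum_comm
    _ = ∑ k, TensorProduct.rid K A ((b.coord k ∘ₗ S).lTensor A (Δ 1 * ((b k * m) ⊗ₜ 1))) := by
        refine Finset.sum_congr rfl fun k _ => ?_
        rw [h2, ← LinearMap.comp_assoc, lTensor_comp, LinearMap.comp_apply,
          hW.lTensor_piL_comul]
    _ = m := by rw [h3, h.antipode_a, hW.piL_one, one_mul]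

end

end WeakHopfAlgebra

/-- Every (nonzero) weak Hopf algebra `A` over a field `K` possesses a
nonzero left integral. -/
theorem weakHopfAlgebra_exists_nonzero_leftIntegral
    (K : Type*) [Field K] (A : Type*) [Ring A] [Algebra K A] [Nontrivial A]
    [FiniteDimensional K A]
    (Δ : A →ₗ[K] A ⊗[K] A) (ε : A →ₗ[K] K) (S : A →ₗ[K] A)
    (hA : WeakHopfAlgebra K A Δ ε S) :
    ∃ l : A, l ≠ 0 ∧ ∀ x : A, x * l = piL K A Δ ε x * l := by
  have b := Module.finBasis K A
  by_contra! hne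
  have hzero : ∀ m, WeakHopfAlgebra.integralProj b Δ S m = 0 := by
    intro m
    by_contra hm
    obtain ⟨x, hx⟩ := hne _ hm
    exact hx (hA.mul_integralProj_eq_piL_mul b x m)
  have h1 := hA.sum_integralProj b 1
  simp [hzero] at h1
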